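/- If u and v are distinct vertices of G with N⟨u⟩ = N⟨v⟩ (twin vertices), then γ_gr(G;C) = γ_gr(G − v; C ∖ {v}), where G − v is the graph obtained from G by deleting v and all edges incident to v, and neighborhoods in (G − v; C ∖ {v}) are defined analogously. -/

import Mathlib

namespace LegalSeq

variable {V : Type*}

/-- The generalized neighborhood `N⟨v⟩`: the closed neighborhood of `v` if `v ∈ C`,
the open neighborhood otherwise. -/
noncomputable def gN [Fintype V] (G : SimpleGraph V) (C : Set V) (v : V) : Finset V := by
  classical
  exact (Set.toFinite (if v ∈ C then insert v (G.neighborSet v) else G.neighborSet v)).toFinset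

/-- Union of the generalized neighborhoods of the vertices of a list. -/
noncomputable def nUnion [Fintype V] (G : SimpleGraph V) (C : Set V) (l : List V) : Finset V := by
  classical
  exact l.toFinset.biUnion (gN G C)

/-- A list of pairwise distinct vertices is a legal sequence if every vertex of the sequence,
except possibly the first one, has a generalized neighbor that is not in the generalized
neighborhood of any preceding vertex. -/
def IsLegal [Fintype V] (G : SimpleGraph V) (C : Set V) (l : List V) : Prop :=
  l.Nodup ∧ ∀ (i : ℕ) (h : i < l.length), 0 < i →
    ¬ (gN G C (l.get ⟨i, h⟩) ⊆ nUnion G C (l.take i))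

/-- A sequence is dominating if the generalized neighborhoods of its members cover all vertices. -/
def IsDom [Fintype V] (G : SimpleGraph V) (C : Set V) (l : List V) : Prop :=
  nUnion G C l = Finset.univ

/-- The Grundy domination number of the instance `(G; C)`: the maximum length of a sequence
that is both legal and dominating. -/
noncomputable def grundy [Fintype V] (G : SimpleGraph V) (C : Set V) : ℕ :=
  sSup {k : ℕ | ∃ l : List V, IsLegal G C l ∧ IsDom G C l ∧ l.length = k}

theorem mem_gN [Fintype V] (G : SimpleGraph V) (C : Set V) (x y : V) :
    y ∈ gN G C x ↔ G.Adj x y ∨ (x ∈ C ∧ y = x) := by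
  unfold gN
  split_ifs with h <;> simp [h, or_comm]

theorem mem_gN_comm [Fintype V] (G : SimpleGraph V) (C : Set V) (x y : V) :
    y ∈ gN G C x ↔ x ∈ gN G C y := by
  rw [mem_gN, mem_gN, G.adj_comm]
  refine or_congr_right ⟨?_, ?_⟩ <;> rintro ⟨h, rfl⟩ <;> exact ⟨h, rfl⟩

theorem mem_gN_comap_val [Fintype V] (G : SimpleGraph V) (C : Set V) (p : V → Prop)
    [Fintype {w : V // p w}] (x y : {w : V // p w}) :
    y ∈ gN (G.comap (Subtype.val : {w : V // p w} → V)) {w : {w : V // p w} | (w : V) ∈ C} x ↔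
      (y : V) ∈ gN G C x := by
  simp [mem_gN, Subtype.ext_iff]

theorem mem_nUnion [Fintype V] (G : SimpleGraph V) (C : Set V) (l : List V) (z : V) :
    z ∈ nUnion G C l ↔ ∃ x ∈ l, z ∈ gN G C x := by
  simp [nUnion]

theorem isDom_iff [Fintype V] (G : SimpleGraph V) (C : Set V) (l : List V) :
    IsDom G C l ↔ ∀ z, ∃ x ∈ l, z ∈ gN G C x := by
  simp [IsDom, Finset.eq_univ_iff_forall, mem_nUnion]

/-- Distinctness of the vertices of a legal sequence is automatic. -/
theorem isLegal_iff [Fintype V] (G : SimpleGraph V) (C : Set V) (l : List V) :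
    IsLegal G C l ↔ ∀ (i : ℕ) (h : i < l.length), 0 < i →
      ∃ z ∈ gN G C l[i], ∀ (j : ℕ) (hj : j < i), z ∉ gN G C l[j] := by
  have key : ∀ (i : ℕ) (h : i < l.length),
      ¬ (gN G C (l.get ⟨i, h⟩) ⊆ nUnion G C (l.take i)) ↔
        ∃ z ∈ gN G C l[i], ∀ (j : ℕ) (hj : j < i), z ∉ gN G C l[j] := by
    intro i h
    simp only [Finset.not_subset, mem_nUnion, List.get_eq_getElem, not_exists, not_and]
    refine exists_congr fun z => and_congr_right fun _ => ⟨fun H j hj => ?_, fun H x hx => ?_⟩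
    · exact H _ (List.mem_take_iff_getElem.2 ⟨j, by omega, rfl⟩)
    · obtain ⟨j, hj, rfl⟩ := List.mem_take_iff_getElem.1 hx
      exact H j (by omega)
  simp only [IsLegal, key, and_iff_right_iff_imp]
  intro H
  rw [List.Nodup, List.pairwise_iff_getElem]
  intro i j hi hj hij heq
  obtain ⟨z, hz, hn⟩ := H j hj (by omega)
  exact hn i hij (heq ▸ hz)

theorem IsLegal.map [Fintype V] {W : Type*} [Fintype W] {G : SimpleGraph V} {C : Set V}
    {H : SimpleGraph W} {D : Set W} {f : V → W}
    (hf : ∀ x y, f y ∈ gN H D (f x) ↔ y ∈ gN G C x) {l : List V} (hl : IsLegal G C l) :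
    IsLegal H D (l.map f) := by
  rw [isLegal_iff] at hl ⊢
  intro i hi hpos
  obtain ⟨z, hz, hn⟩ := hl i (by simpa using hi) hpos
  refine ⟨f z, ?_, fun j hj => ?_⟩
  · simpa [hf] using hz
  · simpa [hf] using hn j hj

theorem grundy_eq_of_leftInverse [Fintype V] {W : Type*} [Fintype W] {G : SimpleGraph V}
    {C : Set V} {H : SimpleGraph W} {D : Set W} {f : V → W} {g : W → V}
    (hf : ∀ x y, f y ∈ gN H D (f x) ↔ y ∈ gN G C x) (hfg : Function.LeftInverse f g) :
    grundy G C = grundy H D := by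
  have hg : ∀ x y, g y ∈ gN G C (g x) ↔ y ∈ gN H D x := fun x y => by
    rw [← hf, hfg, hfg]
  unfold grundy
  congr 1
  ext k
  constructor
  · rintro ⟨l, hl, hd, rfl⟩
    refine ⟨l.map f, hl.map hf, ?_, by simp⟩
    rw [isDom_iff] at hd ⊢
    intro z
    obtain ⟨x, hx, hz⟩ := hd (g z)
    exact ⟨f x, List.mem_map_of_mem hx, by rwa [← hf, hfg] at hz⟩
  · rintro ⟨l, hl, hd, rfl⟩
    refine ⟨l.map g, hl.map hg, ?_, by simp⟩
    rw [isDom_iff] at hd ⊢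
    intro z
    obtain ⟨x, hx, hz⟩ := hd (f z)
    exact ⟨g x, List.mem_map_of_mem hx, by rwa [← hf, hfg]⟩

/-- If `u, v` are twin vertices (`N⟨u⟩ = N⟨v⟩`) then deleting `v` does not
change the Grundy domination number: `γ_gr(G;C) = γ_gr(G − v; C ∖ {v})`. -/
theorem grundy_delete_twin [Fintype V] [DecidableEq V]
    (G : SimpleGraph V) (C : Set V)
    (hiso : ∀ w : V, w ∉ C → ∃ z, G.Adj w z)
    (u v : V) (huv : u ≠ v) (htwin : gN G C u = gN G C v) :
    grundy G C =
      grundy (G.comap (Subtype.val : {w : V // w ≠ v} → V))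
        {w : {w : V // w ≠ v} | (w : V) ∈ C} := by
  have hmem : ∀ x, u ∈ gN G C x ↔ v ∈ gN G C x := fun x => by
    rw [mem_gN_comm, htwin, mem_gN_comm]
  refine grundy_eq_of_leftInverse
    (f := fun x => if h : x = v then ⟨u, huv⟩ else ⟨x, h⟩) (g := Subtype.val) ?_ ?_
  · intro x y
    rw [mem_gN_comap_val]
    by_cases hx : x = v <;> by_cases hy : y = v <;> simp [hx, hy, htwin, hmem]
  · intro x
    simp [x.2]

end LegalSeq
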